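/- For temporary exchange instances with four agents, there exists no mechanism that is individually rational, Pareto optimal, and strategyproof. That is, there is no function f mapping each preference profile (a total preorder over N × N for each of the four agents) to an allocation, such that f always returns an individually rational and Pareto optimal allocation, and no agent i can ever obtain a strictly preferred outcome (with respect to her true preference) by reporting a different preference relation. -/

import Mathlib

open scoped Classical

/-- The outcome of agent `i` under allocation `σ`: the owner of the house `i` receives,
and the tenant who receives `i`'s own house. -/
def outcome {N : Type*} (σ : Equiv.Perm N) (i : N) : N × N := (σ i, σ.symm i)

/-- Strict preference derived from a weak preference relation `r`. -/
def SPref {α : Type*} (r : α → α → Prop) (a b : α) : Prop := r a b ∧ ¬ r b a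

/-- `r` is a total preorder: total and transitive. -/
def TotalPreorderRel {α : Type*} (r : α → α → Prop) : Prop :=
  (∀ a b, r a b ∨ r b a) ∧ (∀ a b c, r a b → r b c → r a c)

/-- An allocation is individually rational if every agent weakly prefers her outcome
to keeping her own house. -/
def IndividuallyRational {N : Type*} (pref : N → (N × N) → (N × N) → Prop)
    (σ : Equiv.Perm N) : Prop :=
  ∀ i, pref i (outcome σ i) (i, i)

/-- An allocation `σ` is Pareto optimal if no allocation makes every agent weakly
better off and some agent strictly better off. -/
def ParetoOptimal {N : Type*} (pref : N → (N × N) → (N × N) → Prop)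
    (σ : Equiv.Perm N) : Prop :=
  ¬ ∃ τ : Equiv.Perm N, (∀ i, pref i (outcome τ i) (outcome σ i)) ∧
      ∃ j, SPref (pref j) (outcome τ j) (outcome σ j)

/-- The weak preference relation represented by the utility function `u`. -/
def utilityPref {α : Type*} (u : α → ℕ) (a b : α) : Prop := u b ≤ u a

instance {α : Type*} (u : α → ℕ) (a b : α) : Decidable (utilityPref u a b) :=
  inferInstanceAs (Decidable (u b ≤ u a))

lemma totalPreorderRel_utilityPref {α : Type*} (u : α → ℕ) :
    TotalPreorderRel (utilityPref u) :=
  ⟨fun a b => le_total (u b) (u a), fun _ _ _ hab hbc => le_trans hbc hab⟩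

lemma sPref_utilityPref_iff {α : Type*} {u : α → ℕ} {a b : α} :
    SPref (utilityPref u) a b ↔ u b < u a := by
  simp only [SPref, utilityPref]; omega

/-- Utility of agent `i` if she only wants bilateral swaps, with `a` or, failing that, with `b`. -/
def swapUtility {N : Type*} [DecidableEq N] (i a b : N) (p : N × N) : ℕ :=
  if p = (a, a) then 3 else if p = (b, b) then 2 else if p = (i, i) then 1 else 0

/-- The profile in which agent `i` likes best to swap with `a i`, and next best with `b i`. -/
def swapProfile {N : Type*} [DecidableEq N] (a b : N → N) (i : N) : N × N → N × N → Prop :=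
  utilityPref (swapUtility i (a i) (b i))

lemma totalPreorderRel_swapProfile {N : Type*} [DecidableEq N] (a b : N → N) (i : N) :
    TotalPreorderRel (swapProfile a b i) :=
  totalPreorderRel_utilityPref _

lemma update_swapProfile {N : Type*} [DecidableEq N] (a b : N → N) (i c : N) :
    Function.update (swapProfile a b) i (utilityPref (swapUtility i (a i) c)) =
      swapProfile a (Function.update b i c) := by
  funext j
  by_cases h : j = i
  · subst h; simp [swapProfile]
  · simp [swapProfile, h]

/-- A computable form of individual rationality and Pareto optimality for swap profiles. -/
def SwapEfficient {N : Type*} [DecidableEq N] (a b : N → N) (σ : Equiv.Perm N) : Prop :=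
  (∀ i, swapUtility i (a i) (b i) (i, i) ≤ swapUtility i (a i) (b i) (outcome σ i)) ∧
    ∀ τ : Equiv.Perm N,
      (∀ i, swapUtility i (a i) (b i) (outcome σ i) ≤
        swapUtility i (a i) (b i) (outcome τ i)) →
      ∀ i, swapUtility i (a i) (b i) (outcome τ i) ≤ swapUtility i (a i) (b i) (outcome σ i)

instance {N : Type*} [DecidableEq N] [Fintype N] (a b : N → N) (σ : Equiv.Perm N) :
    Decidable (SwapEfficient a b σ) :=
  inferInstanceAs (Decidable (_ ∧ _))

lemma swapEfficient_of_ir_po {N : Type*} [DecidableEq N] {a b : N → N} {σ : Equiv.Perm N}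
    (h : IndividuallyRational (swapProfile a b) σ ∧ ParetoOptimal (swapProfile a b) σ) :
    SwapEfficient a b σ := by
  refine ⟨h.1, fun τ hτ i => ?_⟩
  by_contra hi
  exact h.2 ⟨τ, hτ, i, sPref_utilityPref_iff.2 (not_le.1 hi)⟩

/-- Two men `0, 1` and two women `2, 3`: the first choice of each agent. -/
def firstChoice : Fin 4 → Fin 4 := ![2, 3, 1, 0]

/-- Two men `0, 1` and two women `2, 3`: the second choice of each agent. -/
def secondChoice : Fin 4 → Fin 4 := ![3, 2, 0, 1]

/-- The second choices after agent `i` declares only her first choice acceptable. -/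
def truncate (b : Fin 4 → Fin 4) (i : Fin 4) : Fin 4 → Fin 4 :=
  Function.update b i (firstChoice i)

lemma swapEfficient_secondChoice : ∀ σ, SwapEfficient firstChoice secondChoice σ →
    outcome σ 0 = (3, 3) ∨ outcome σ 2 = (0, 0) := by
  decide +kernel

lemma swapEfficient_truncate {i j : Fin 4} (hij : (i, j) = (0, 1) ∨ (i, j) = (2, 3)) :
    ∀ σ, SwapEfficient firstChoice (truncate secondChoice i) σ →
      outcome σ i = (firstChoice i, firstChoice i) ∨
        outcome σ j = (secondChoice j, secondChoice j) := by
  revert i j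
  decide +kernel

lemma swapEfficient_truncate_truncate {i j : Fin 4}
    (hij : (i, j) = (0, 1) ∨ (i, j) = (2, 3)) :
    ∀ σ, SwapEfficient firstChoice (truncate (truncate secondChoice i) j) σ →
      outcome σ j = (firstChoice j, firstChoice j) := by
  revert i j
  decide +kernel

lemma swapUtility_second_lt_first {i : Fin 4} :
    swapUtility i (firstChoice i) (secondChoice i) (secondChoice i, secondChoice i) <
      swapUtility i (firstChoice i) (secondChoice i) (firstChoice i, firstChoice i) := by
  revert i
  decide +kernel

/-- for temporary exchange instances with four agents, there is no
individually rational, Pareto optimal, and strategyproof mechanism. -/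
theorem no_IR_PO_SP_mechanism :
    ¬ ∃ f : (Fin 4 → (Fin 4 × Fin 4) → (Fin 4 × Fin 4) → Prop) → Equiv.Perm (Fin 4),
      (∀ pref, (∀ i, TotalPreorderRel (pref i)) →
          IndividuallyRational pref (f pref) ∧ ParetoOptimal pref (f pref)) ∧
      (∀ pref, (∀ i, TotalPreorderRel (pref i)) →
        ∀ (i : Fin 4) (r' : (Fin 4 × Fin 4) → (Fin 4 × Fin 4) → Prop),
          TotalPreorderRel r' →
          ¬ SPref (pref i) (outcome (f (Function.update pref i r')) i)
              (outcome (f pref) i)) := by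
  rintro ⟨f, hf, hsp⟩
  have heff (b : Fin 4 → Fin 4) : SwapEfficient firstChoice b (f (swapProfile firstChoice b)) :=
    swapEfficient_of_ir_po (hf _ (totalPreorderRel_swapProfile _ _))
  have htrunc (b : Fin 4 → Fin 4) (i : Fin 4) (hb : b i = secondChoice i)
      (h : outcome (f (swapProfile firstChoice b)) i = (secondChoice i, secondChoice i)) :
      outcome (f (swapProfile firstChoice (truncate b i))) i ≠
        (firstChoice i, firstChoice i) := by
    intro h'
    have key := hsp _ (totalPreorderRel_swapProfile firstChoice b) i _
      (totalPreorderRel_utilityPref (swapUtility i (firstChoice i) (firstChoice i)))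
    rw [update_swapProfile, h, swapProfile, sPref_utilityPref_iff, hb] at key
    exact key (by rw [← truncate, h']; exact swapUtility_second_lt_first)
  have hchain (i j : Fin 4) (hij : (i, j) = (0, 1) ∨ (i, j) = (2, 3)) :
      outcome (f (swapProfile firstChoice secondChoice)) i ≠
        (secondChoice i, secondChoice i) := by
    intro h
    have hj := (swapEfficient_truncate hij _ (heff _)).resolve_left (htrunc _ i rfl h)
    have hne : j ≠ i := by rintro rfl; simp at hij; omega
    exact htrunc _ j (by simp [truncate, hne]) hj
      (swapEfficient_truncate_truncate hij _ (heff _))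
  rcases swapEfficient_secondChoice _ (heff _) with h | h
  · exact hchain 0 1 (Or.inl rfl) h
  · exact hchain 2 3 (Or.inr rfl) h
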